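/- arXiv:2205.03728 — 2 statements merged into one kernel-verified Lean document; each statement's English description precedes it below -/
import Mathlib

section
/- Let s > 0, let T be a positive integer, and let y ∈ {0,1}^T be a binary string with exactly k ones, where 1 ≤ k ≤ T. Then sup{ Π_{t=1}^T p_t^{y_t}·(1−p_t)^{1−y_t} : p ∈ [0,1]^T, Σ_{t=1}^T p_t^s ≤ 1 } = k^{−k/s}, and the supremum is attained by the vector p with p_t = k^{−1/s} at the coordinates where y_t = 1 and p_t = 0 elsewhere. -/
open Set

/-- If nonnegative reals indexed by a nonempty finset have `s`-th powers summing to at most one,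
their product is at most `(#A) ^ (-(#A / s))`. -/
theorem prod_le_card_rpow_of_sum_rpow_le_one {ι : Type*} (A : Finset ι) (hA : A.Nonempty)
    (p : ι → ℝ) (hp : ∀ i ∈ A, 0 ≤ p i) {s : ℝ} (hs : 0 < s) (h : ∑ i ∈ A, p i ^ s ≤ 1) :
    ∏ i ∈ A, p i ≤ (A.card : ℝ) ^ (-((A.card : ℝ) / s)) := by
  have hk : (0 : ℝ) < A.card := by exact_mod_cast hA.card_pos
  have hps : ∀ i ∈ A, 0 ≤ p i ^ s := fun i hi => Real.rpow_nonneg (hp i hi) s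
  have amgm : ∏ i ∈ A, (p i ^ s) ^ (A.card : ℝ)⁻¹ ≤ (A.card : ℝ)⁻¹ :=
    calc
      _ ≤ ∑ i ∈ A, (A.card : ℝ)⁻¹ * p i ^ s :=
        Real.geom_mean_le_arith_mean_weighted A (fun _ => (A.card : ℝ)⁻¹) (fun i => p i ^ s)
          (fun _ _ => by positivity) (by simp [hk.ne']) hps
      _ ≤ (A.card : ℝ)⁻¹ := by
        rw [← Finset.mul_sum]
        exact mul_le_of_le_one_right (by positivity) h
  have hroot : ∀ i ∈ A, 0 ≤ (p i ^ s) ^ (A.card : ℝ)⁻¹ :=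
    fun i hi => Real.rpow_nonneg (hps i hi) _
  calc
    ∏ i ∈ A, p i = (∏ i ∈ A, (p i ^ s) ^ (A.card : ℝ)⁻¹) ^ ((A.card : ℝ) / s) := by
      rw [← Real.finsetProd_rpow _ _ hroot]
      refine Finset.prod_congr rfl fun i hi => ?_
      rw [← Real.rpow_mul (hp i hi), ← Real.rpow_mul (hp i hi)]
      have : s * (A.card : ℝ)⁻¹ * ((A.card : ℝ) / s) = 1 := by field_simp
      rw [this, Real.rpow_one]
    _ ≤ ((A.card : ℝ)⁻¹) ^ ((A.card : ℝ) / s) :=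
      Real.rpow_le_rpow (Finset.prod_nonneg hroot) amgm (by positivity)
    _ = _ := by rw [Real.inv_rpow hk.le, Real.rpow_neg hk.le]

/-- The maximum-probability computation in the proof of Theorem 8: for a binary
string `y ∈ {0,1}^T` with exactly `k ≥ 1` ones, the supremum of
`Π_t p_t^{y_t} (1-p_t)^{1-y_t}` over `p ∈ [0,1]^T` with `Σ_t p_t^s ≤ 1` equals
`k^{-k/s}`, and it is attained at the vector `p₀` with `p₀_t = k^{-1/s}` where
`y_t = 1` and `p₀_t = 0` elsewhere. -/
theorem bernoulli_max_prob_ls_constraint (s : ℝ) (hs : 0 < s)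
    (T : ℕ) (hT : 0 < T) (y : Fin T → Bool) (k : ℕ)
    (hk : k = (Finset.univ.filter fun t => y t = true).card) (hk1 : 1 ≤ k) :
    sSup ((fun p : Fin T → ℝ => ∏ t, (if y t then p t else 1 - p t)) ''
        {p : Fin T → ℝ | (∀ t, p t ∈ Set.Icc (0:ℝ) 1) ∧ ∑ t, p t ^ s ≤ 1}) =
      (k : ℝ) ^ (-((k : ℝ) / s)) ∧
    (fun t : Fin T => if y t then (k : ℝ) ^ (-(1 / s)) else 0) ∈
      {p : Fin T → ℝ | (∀ t, p t ∈ Set.Icc (0:ℝ) 1) ∧ ∑ t, p t ^ s ≤ 1} ∧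
    (∏ t, (if y t then (if y t then (k : ℝ) ^ (-(1 / s)) else 0)
           else 1 - (if y t then (k : ℝ) ^ (-(1 / s)) else 0))) =
      (k : ℝ) ^ (-((k : ℝ) / s)) := by
  have hk0 : (0 : ℝ) < k := by exact_mod_cast hk1
  have hmem : (fun t : Fin T => if y t then (k : ℝ) ^ (-(1 / s)) else 0) ∈
      {p : Fin T → ℝ | (∀ t, p t ∈ Set.Icc (0:ℝ) 1) ∧ ∑ t, p t ^ s ≤ 1} := by
    refine ⟨fun t => ?_, ?_⟩
    · dsimp only
      split_ifs
      · exact ⟨by positivity, Real.rpow_le_one_of_one_le_of_nonpos (by exact_mod_cast hk1)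
          (by simp only [Left.neg_nonpos_iff]; positivity)⟩
      · simp
    · have hpow : ((k : ℝ) ^ (-(1 / s))) ^ s = (k : ℝ)⁻¹ := by
        rw [← Real.rpow_mul hk0.le, ← Real.rpow_neg_one]
        congr 1
        field_simp
      have hterm : ∀ t, (if y t then (k : ℝ) ^ (-(1 / s)) else 0) ^ s =
          if y t then (k : ℝ)⁻¹ else 0 := fun t => by
        split_ifs
        · exact hpow
        · exact Real.zero_rpow hs.ne'
      simp only [hterm]
      rw [← Finset.sum_filter, Finset.sum_const, ← hk, nsmul_eq_mul, mul_inv_cancel₀ hk0.ne']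
  have hval : (∏ t, (if y t then (if y t then (k : ℝ) ^ (-(1 / s)) else 0)
      else 1 - (if y t then (k : ℝ) ^ (-(1 / s)) else 0))) = (k : ℝ) ^ (-((k : ℝ) / s)) := by
    have hterm : ∀ t, (if y t then (if y t then (k : ℝ) ^ (-(1 / s)) else 0)
        else 1 - (if y t then (k : ℝ) ^ (-(1 / s)) else 0)) =
        if y t then (k : ℝ) ^ (-(1 / s)) else 1 := fun t => by
      split_ifs <;> simp
    simp only [hterm]
    rw [← Finset.prod_filter, Finset.prod_const, ← hk, ← Real.rpow_mul_natCast hk0.le]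
    congr 1
    ring
  refine ⟨IsGreatest.csSup_eq ⟨⟨_, hmem, hval⟩, ?_⟩, hmem, hval⟩
  rintro _ ⟨p, ⟨hp, hsum⟩, rfl⟩
  calc
    ∏ t, (if y t then p t else 1 - p t) ≤ ∏ t, (if y t then p t else 1) := by
      refine Finset.prod_le_prod (fun t _ => ?_) (fun t _ => ?_) <;> split_ifs <;>
        linarith [(hp t).1, (hp t).2]
    _ = ∏ t ∈ Finset.univ.filter (fun t => y t = true), p t := (Finset.prod_filter _ _).symm
    _ ≤ (k : ℝ) ^ (-((k : ℝ) / s)) := by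
      rw [hk]
      refine prod_le_card_rpow_of_sum_rpow_le_one _ (Finset.card_pos.mp (hk ▸ hk1)) p
        (fun t _ => (hp t).1) hs (le_trans ?_ hsum)
      exact Finset.sum_le_sum_of_subset_of_nonneg (Finset.filter_subset _ _)
        fun t _ _ => Real.rpow_nonneg (hp t).1 s
end

section
/- For every s ≥ 1 there exist a constant c > 0 and an integer T₀ such that for all integers T ≥ T₀: Σ_{k=1}^T C(T,k)·k^{−k/s} ≥ exp( c·T^{s/(s+1)} ), where C(T,k) is the binomial coefficient. -/
open Set

theorem Nat.div_pow_le_choose {n k : ℕ} (hk : k ≤ n) :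
    ((n : ℝ) / k) ^ k ≤ (n.choose k : ℝ) := by
  induction k generalizing n with
  | zero => simp
  | succ k ih =>
    obtain ⟨m, rfl⟩ : ∃ m, n = m + 1 := ⟨n - 1, by omega⟩
    have hkm : k ≤ m := by omega
    have hkm' : (k : ℝ) ≤ m := by exact_mod_cast hkm
    have hrec : ((m + 1).choose (k + 1) : ℝ) = ((m : ℝ) + 1) / (k + 1) * m.choose k := by
      have h : ((m : ℝ) + 1) * m.choose k = (m + 1).choose (k + 1) * ((k : ℝ) + 1) := by
        exact_mod_cast Nat.add_one_mul_choose_eq m k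
      field_simp
      linarith
    rw [hrec, _root_.pow_succ', Nat.cast_add_one, Nat.cast_add_one]
    gcongr
    refine le_trans ?_ (ih hkm)
    rcases Nat.eq_zero_or_pos k with rfl | hpos
    · simp
    have hpos' : (0 : ℝ) < k := by exact_mod_cast hpos
    refine pow_le_pow_left₀ (by positivity) ?_ k
    rw [div_le_div_iff₀ (by positivity) hpos']
    linarith

/-- The Shtarkov-sum estimate in the proof of Theorem 8: for every `s ≥ 1` there
are `c > 0` and `T₀` with `Σ_{k=1}^T C(T,k) k^{-k/s} ≥ exp(c T^{s/(s+1)})`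
for all `T ≥ T₀`. -/
theorem shtarkov_sum_Ds_lower (s : ℝ) (hs : 1 ≤ s) :
    ∃ c : ℝ, 0 < c ∧ ∃ T₀ : ℕ, ∀ T : ℕ, T₀ ≤ T →
      Real.exp (c * (T : ℝ) ^ (s / (s + 1))) ≤
        ∑ k ∈ Finset.Icc 1 T, (T.choose k : ℝ) * (k : ℝ) ^ (-((k : ℝ) / s)) := by
  have hs0 : 0 < s := by linarith
  have hp : 0 < s / (s + 1) := by positivity
  have hp1 : s / (s + 1) ≤ 1 := by rw [div_le_one (by positivity)]; linarith
  refine ⟨Real.exp (-1) / 2, by positivity, ?_⟩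
  have hlarge : ∀ᶠ T : ℕ in Filter.atTop, 2 ≤ Real.exp (-1) * (T : ℝ) ^ (s / (s + 1)) :=
    (((tendsto_rpow_atTop hp).comp tendsto_natCast_atTop_atTop).const_mul_atTop
      (Real.exp_pos (-1))).eventually_ge_atTop 2
  obtain ⟨T₀, hT₀⟩ := Filter.eventually_atTop.1 (hlarge.and (Filter.eventually_ge_atTop 1))
  refine ⟨T₀, fun T hT => ?_⟩
  obtain ⟨hx, hT1⟩ := hT₀ T hT
  have hT1' : (1 : ℝ) ≤ T := by exact_mod_cast hT1
  have hT0 : (0 : ℝ) < T := by linarith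
  have hTp : 0 < (T : ℝ) ^ (s / (s + 1)) := by positivity
  set x := Real.exp (-1) * (T : ℝ) ^ (s / (s + 1)) with hxdef
  set k := ⌊x⌋₊ with hkdef
  have hkx : (k : ℝ) ≤ x := Nat.floor_le (by linarith)
  have hxk : x < k + 1 := Nat.lt_floor_add_one x
  have hk0 : (0 : ℝ) < k := by linarith
  have hk1 : 1 ≤ k := by exact_mod_cast hk0
  have hxT : x ≤ T := by
    have h : (T : ℝ) ^ (s / (s + 1)) ≤ T := Real.rpow_le_self_of_one_le hT1' hp1
    have he : Real.exp (-1) ≤ 1 := Real.exp_le_one_iff.2 (by norm_num)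
    nlinarith
  have hkT : k ≤ T := by exact_mod_cast hkx.trans hxT
  have hlog : Real.log k ≤ -1 + s / (s + 1) * Real.log T := by
    have h := Real.log_le_log hk0 hkx
    rwa [hxdef, Real.log_mul (Real.exp_ne_zero _) hTp.ne', Real.log_exp,
      Real.log_rpow hT0] at h
  have hexponent : 1 ≤ Real.log T - Real.log k - Real.log k / s := by
    have h : Real.log k * ((s + 1) / s) ≤ -((s + 1) / s) + Real.log T :=
      calc _ ≤ (-1 + s / (s + 1) * Real.log T) * ((s + 1) / s) := by gcongr
        _ = _ := by field_simp
    have h1 : (s + 1) / s = 1 + 1 / s := by field_simp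
    have h2 : 0 < 1 / s := by positivity
    rw [h1] at h
    rw [div_eq_mul_one_div]
    linarith
  calc Real.exp (Real.exp (-1) / 2 * (T : ℝ) ^ (s / (s + 1)))
      = Real.exp (x / 2) := by rw [hxdef]; ring_nf
    _ ≤ Real.exp (k * (Real.log T - Real.log k - Real.log k / s)) := by
        gcongr
        nlinarith
    _ = ((T : ℝ) / k) ^ k * (k : ℝ) ^ (-((k : ℝ) / s)) := by
        rw [← Real.rpow_natCast, Real.rpow_def_of_pos (by positivity),
          Real.rpow_def_of_pos hk0, Real.log_div hT0.ne' hk0.ne', ← Real.exp_add]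
        ring_nf
    _ ≤ (T.choose k : ℝ) * (k : ℝ) ^ (-((k : ℝ) / s)) := by
        gcongr
        exact Nat.div_pow_le_choose hkT
    _ ≤ _ := Finset.single_le_sum
        (f := fun k : ℕ => (T.choose k : ℝ) * (k : ℝ) ^ (-((k : ℝ) / s)))
        (fun i _ => by positivity) (Finset.mem_Icc.2 ⟨hk1, hkT⟩)
end
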